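/- Let G be a connected paired threshold graph and let I ⊎ U be a canonical paired threshold partition of G with p = |I|. Suppose the graph obtained from G by deleting all universal vertices is connected. Then for every clique path C₁, …, C_ℓ of G, either every maximal clique C_i that contains a vertex of I satisfies i ≤ p, or every such C_i satisfies i > ℓ − p. -/

import Mathlib

/-- `G` is a paired threshold graph: there are positive vertex weights and two
positive thresholds such that distinct vertices are adjacent iff their weight
sum is at least `Tp` and their weight difference is at most `Tm`. -/
def IsPairedThresholdGraph {V : Type*} (G : SimpleGraph V) : Prop :=
  ∃ (w : V → ℝ) (Tp Tm : ℝ), (∀ v, 0 < w v) ∧ 0 < Tp ∧ 0 < Tm ∧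
    ∀ u v, u ≠ v → (G.Adj u v ↔ Tp ≤ w u + w v ∧ |w u - w v| ≤ Tm)

/-- `G` is an interval graph: vertices can be assigned nonempty closed real
intervals so that distinct vertices are adjacent iff their intervals meet. -/
def IsIntervalGraph {V : Type*} (G : SimpleGraph V) : Prop :=
  ∃ l r : V → ℝ, (∀ v, l v ≤ r v) ∧
    ∀ u v, u ≠ v →
      (G.Adj u v ↔ (Set.Icc (l u) (r u) ∩ Set.Icc (l v) (r v)).Nonempty)

/-- `G` is a unit interval graph: vertices can be assigned closed real intervals
of length one so that distinct vertices are adjacent iff their intervals meet. -/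
def IsUnitIntervalGraph {V : Type*} (G : SimpleGraph V) : Prop :=
  ∃ l : V → ℝ,
    ∀ u v, u ≠ v →
      (G.Adj u v ↔ (Set.Icc (l u) (l u + 1) ∩ Set.Icc (l v) (l v + 1)).Nonempty)

/-- `G` is a threshold graph: there are positive vertex weights and a positive
threshold such that distinct vertices are adjacent iff their weight sum is at
least `T`. -/
def IsThresholdGraph {V : Type*} (G : SimpleGraph V) : Prop :=
  ∃ (w : V → ℝ) (T : ℝ), (∀ v, 0 < w v) ∧ 0 < T ∧
    ∀ u v, u ≠ v → (G.Adj u v ↔ T ≤ w u + w v)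

/-- Closed neighborhood `N[X]` of a vertex set. -/
def closedNbhd {V : Type*} (G : SimpleGraph V) (X : Set V) : Set V :=
  X ∪ {u | ∃ x ∈ X, G.Adj x u}

/-- Open neighborhood `N(X)` of a vertex set. -/
def openNbhd {V : Type*} (G : SimpleGraph V) (X : Set V) : Set V :=
  closedNbhd G X \ X

/-- A vertex is simplicial if its closed neighborhood is a clique. -/
def IsSimplicial {V : Type*} (G : SimpleGraph V) (v : V) : Prop :=
  G.IsClique (insert v (G.neighborSet v))

/-- A broom ordering of `G` (vertices indexed `0, …, n-1` by the bijection `σ`):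
the reversal of `σ` is an interval ordering, and there is `p` such that the first
`p` vertices have all their neighbors after position `p`, occupying consecutive
positions, while the last `n - p` vertices form an umbrella ordering. -/
def IsBroomOrdering {V : Type*} [Fintype V] (G : SimpleGraph V)
    (σ : V ≃ Fin (Fintype.card V)) : Prop :=
  (∀ x y z : V, σ x < σ y → σ y < σ z → G.Adj x z → G.Adj y z) ∧
  ∃ p : ℕ, p ≤ Fintype.card V ∧
    (∀ u : V, (σ u : ℕ) < p →
      (∀ v : V, G.Adj u v → p ≤ (σ v : ℕ)) ∧
      (∀ a b c : Fin (Fintype.card V),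
        (∃ x, G.Adj u x ∧ σ x = a) → (∃ x, G.Adj u x ∧ σ x = c) →
        a ≤ b → b ≤ c → ∃ x, G.Adj u x ∧ σ x = b)) ∧
    (∀ x y z : V, p ≤ (σ x : ℕ) → σ x < σ y → σ y < σ z →
      G.Adj x z → G.Adj x y ∧ G.Adj y z)

/-- An umbrella ordering of a graph `H`. -/
def IsUmbrellaOrdering {W : Type*} (H : SimpleGraph W) (σ : W ≃ Fin (Nat.card W)) : Prop :=
  ∀ x y z : W, σ x < σ y → σ y < σ z → H.Adj x z → H.Adj x y ∧ H.Adj y z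

/-- `I ⊎ U` is a paired threshold partition of `G`. -/
def IsPairedThresholdPartition {V : Type*} (G : SimpleGraph V) (I U : Set V) : Prop :=
  I ∪ U = Set.univ ∧ Disjoint I U ∧
  (∀ x ∈ I, ∀ y ∈ I, ¬ G.Adj x y) ∧
  IsUnitIntervalGraph (G.induce U) ∧
  IsThresholdGraph (G.induce (closedNbhd G I)) ∧
  ∃ σ : ↥U ≃ Fin (Nat.card ↥U),
    IsUmbrellaOrdering (G.induce U) σ ∧
    (∀ v ∈ I, ∀ a b c : Fin (Nat.card ↥U),
      (∃ x : ↥U, G.Adj v ↑x ∧ σ x = a) → (∃ x : ↥U, G.Adj v ↑x ∧ σ x = c) →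
      a ≤ b → b ≤ c → ∃ x : ↥U, G.Adj v ↑x ∧ σ x = b) ∧
    (∀ u : ↥U, (σ u : ℕ) = 0 → openNbhd G I ⊆ insert (↑u) (G.neighborSet ↑u))

/-- A canonical paired threshold partition: `I` cannot be enlarged by moving a
vertex of `U` into it. -/
def IsCanonicalPTPartition {V : Type*} (G : SimpleGraph V) (I U : Set V) : Prop :=
  IsPairedThresholdPartition G I U ∧
  ∀ v ∈ U, ¬ IsPairedThresholdPartition G (insert v I) (U \ {v})

/-- A maximal clique of `G`. -/
def IsMaximalClique {V : Type*} (G : SimpleGraph V) (s : Set V) : Prop :=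
  G.IsClique s ∧ ∀ t : Set V, G.IsClique t → s ⊆ t → s = t

/-- A clique path of `G`: a sequence listing each maximal clique exactly once,
in which the cliques containing any fixed vertex occur consecutively. -/
def IsCliquePath {V : Type*} (G : SimpleGraph V) {ℓ : ℕ} (C : Fin ℓ → Set V) : Prop :=
  Function.Injective C ∧
  (∀ i, IsMaximalClique G (C i)) ∧
  (∀ s : Set V, IsMaximalClique G s → ∃ i, C i = s) ∧
  (∀ v : V, ∀ i j k : Fin ℓ, i ≤ j → j ≤ k → v ∈ C i → v ∈ C k → v ∈ C j)

/-- The combinatorial content of a paired threshold partition, with the umbrella ordering of `U`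
given by an integer ranking `f` that is injective on `U`. -/
structure IsRankedPartition {V : Type*} (G : SimpleGraph V) (I U : Set V) (f : V → ℕ) : Prop where
  cover : ∀ v, v ∈ I ∨ v ∈ U
  disj : ∀ v ∈ I, v ∉ U
  indep : ∀ x ∈ I, ∀ y ∈ I, ¬ G.Adj x y
  inj : ∀ x ∈ U, ∀ y ∈ U, f x = f y → x = y
  umbrella : ∀ x ∈ U, ∀ y ∈ U, ∀ z ∈ U, f x < f y → f y < f z → G.Adj x z →
    G.Adj x y ∧ G.Adj y z
  consec : ∀ v ∈ I, ∀ x ∈ U, ∀ y ∈ U, ∀ z ∈ U, G.Adj v x → G.Adj v z →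
    f x ≤ f y → f y ≤ f z → G.Adj v y
  first : ∀ u ∈ U, (∀ g ∈ U, f u ≤ f g) → ∀ v ∈ I, ∀ g, G.Adj v g → g = u ∨ G.Adj u g

namespace IsPairedThresholdPartition

variable {V : Type*} {G : SimpleGraph V} {I U : Set V}

theorem exists_ranking (h : IsPairedThresholdPartition G I U) :
    ∃ f : V → ℕ, IsRankedPartition G I U f := by
  classical
  obtain ⟨hcover, hdisj, hind, -, -, σ, humb, hcons, hfirst⟩ := h
  have hf : ∀ x (hx : x ∈ U), (if h : x ∈ U then (σ ⟨x, h⟩ : ℕ) else 0) = σ ⟨x, hx⟩ :=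
    fun x hx => dif_pos hx
  have hcover' : ∀ v, v ∈ I ∨ v ∈ U := fun v => by
    have : v ∈ I ∪ U := hcover ▸ Set.mem_univ v
    exact this
  have hdisj' : ∀ v ∈ I, v ∉ U := fun v hv hv' => Set.disjoint_left.1 hdisj hv hv'
  refine ⟨fun v => if h : v ∈ U then (σ ⟨v, h⟩ : ℕ) else 0, hcover', hdisj', hind, ?_, ?_, ?_, ?_⟩
  · intro x hx y hy hxy
    simp only [hf x hx, hf y hy] at hxy
    simpa using σ.injective (Fin.ext hxy)
  · intro x hx y hy z hz hxy hyz hadj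
    simp only [hf x hx, hf y hy, hf z hz] at hxy hyz
    exact humb ⟨x, hx⟩ ⟨y, hy⟩ ⟨z, hz⟩ hxy hyz hadj
  · intro v hv x hx y hy z hz hvx hvz hxy hyz
    simp only [hf x hx, hf y hy, hf z hz] at hxy hyz
    obtain ⟨t, ht, hty⟩ := hcons v hv _ (σ ⟨y, hy⟩) _ ⟨⟨x, hx⟩, hvx, rfl⟩ ⟨⟨z, hz⟩, hvz, rfl⟩
      hxy hyz
    rwa [σ.injective hty] at ht
  · intro u hu hmin v hv g hg
    have hpos : 0 < Nat.card U := (Nat.zero_le _).trans_lt (σ ⟨u, hu⟩).isLt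
    have hzero : (σ ⟨u, hu⟩ : ℕ) = 0 := by
      obtain ⟨⟨t, ht⟩, hσt⟩ := σ.surjective ⟨0, hpos⟩
      have := hmin t ht
      simp only [hf u hu, hf t ht] at this
      rw [hσt] at this
      exact Nat.le_zero.1 this
    have hgI : g ∉ I := fun hgI => hind v hv g hgI hg
    simpa using hfirst ⟨u, hu⟩ hzero ⟨Or.inr ⟨v, hv, hg⟩, hgI⟩

end IsPairedThresholdPartition

/-- A finite type with an injective ranking has an increasing enumeration. -/
theorem exists_equiv_fin_lt_iff {W : Type*} [Finite W] (f : W → ℕ) (hf : Function.Injective f) :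
    ∃ σ : W ≃ Fin (Nat.card W), ∀ x y, σ x < σ y ↔ f x < f y := by
  have := Fintype.ofFinite W
  let _ : LinearOrder W := LinearOrder.lift' f hf
  let e := Fintype.orderIsoFinOfCardEq W (Nat.card_eq_fintype_card (α := W)).symm
  exact ⟨e.symm.toEquiv, fun x y => e.symm.lt_iff_lt⟩

namespace IsRankedPartition

variable {V : Type*} {G : SimpleGraph V} {I U : Set V} {f : V → ℕ}

theorem isPairedThresholdPartition [Finite V] (h : IsRankedPartition G I U f)
    (hunit : IsUnitIntervalGraph (G.induce U))
    (hthr : IsThresholdGraph (G.induce (closedNbhd G I))) :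
    IsPairedThresholdPartition G I U := by
  obtain ⟨σ, hσ⟩ := exists_equiv_fin_lt_iff (fun x : U => f x)
    (fun x y hxy => Subtype.ext (h.inj x x.2 y y.2 hxy))
  have hσ' : ∀ x y, σ x ≤ σ y ↔ f x ≤ f y := fun x y => by
    rw [← not_lt, ← not_lt, hσ]
  refine ⟨Set.eq_univ_of_forall h.cover, Set.disjoint_left.2 h.disj, h.indep, hunit, hthr,
    σ, ?_, ?_, ?_⟩
  · intro x y z hxy hyz hadj
    exact h.umbrella x x.2 y y.2 z z.2 ((hσ _ _).1 hxy) ((hσ _ _).1 hyz) hadj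
  · rintro v hv a b c ⟨x, hvx, rfl⟩ ⟨z, hvz, rfl⟩ hab hbc
    obtain ⟨y, rfl⟩ := σ.surjective b
    exact ⟨y, h.consec v hv x x.2 y y.2 z z.2 hvx hvz ((hσ' _ _).1 hab) ((hσ' _ _).1 hbc), rfl⟩
  · rintro u hu g ⟨hg | ⟨v, hv, hvg⟩, hgI⟩
    · exact absurd hg hgI
    · refine h.first u u.2 (fun t ht => (hσ' u ⟨t, ht⟩).1 ?_) v hv g hvg
      rw [Fin.le_def, hu]
      exact Nat.zero_le _

theorem mem_of_adj (h : IsRankedPartition G I U f) {v g : V} (hv : v ∈ I) (hg : G.Adj v g) :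
    g ∈ U :=
  (h.cover g).resolve_left fun hgI => h.indep v hv g hgI hg

/-- The neighbours in `U` of the first vertex are pairwise adjacent. -/
theorem adj_of_first (h : IsRankedPartition G I U f) {u : V} (hu : u ∈ U)
    (hmin : ∀ g ∈ U, f u ≤ f g) {x y : V} (hx : x ∈ U) (hy : y ∈ U)
    (hux : x = u ∨ G.Adj u x) (huy : y = u ∨ G.Adj u y) (hxy : x ≠ y) : G.Adj x y := by
  have key : ∀ x ∈ U, ∀ y ∈ U, (y = u ∨ G.Adj u y) → f x < f y → G.Adj x y := by
    intro x hx y hy huy hlt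
    have huy' : G.Adj u y := huy.resolve_left fun e => by
      have := hmin x hx
      rw [← e] at this
      omega
    rcases (hmin x hx).eq_or_lt with e | hlt'
    · rwa [← h.inj u hu x hx e]
    · exact (h.umbrella u hu x hx y hy hlt' hlt huy').2
  rcases lt_trichotomy (f x) (f y) with hlt | e | hlt
  · exact key x hx y hy huy hlt
  · exact absurd (h.inj x hx y hy e) hxy
  · exact (key y hy x hx hux hlt).symm

theorem first_of_le (h : IsRankedPartition G I U f) {u : V} (hu : u ∈ U)
    (hmin : ∀ g ∈ U, f u ≤ f g) {x y : V} (hx : x ∈ U) (hy : y ∈ U)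
    (huy : y = u ∨ G.Adj u y) (hxy : f x ≤ f y) : x = u ∨ G.Adj u x := by
  rcases hxy.eq_or_lt with e | hlt
  · rwa [h.inj x hx y hy e]
  rcases (hmin x hx).eq_or_lt with e | hlt'
  · exact Or.inl (h.inj u hu x hx e).symm
  · refine Or.inr (h.umbrella u hu x hx y hy hlt' hlt (huy.resolve_left fun e => ?_)).1
    rw [e] at hlt
    omega

/-- The first vertex of `U`, when it has no neighbour in `I`, can be moved to `I`. -/
theorem move_first (h : IsRankedPartition G I U f) {u : V} (hu : u ∈ U)
    (hmin : ∀ g ∈ U, f u ≤ f g) (hno : ∀ v ∈ I, ¬ G.Adj v u) :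
    IsRankedPartition G (insert u I) (U \ {u}) f := by
  have hlt : ∀ g ∈ U, g ≠ u → f u < f g := fun g hg hgu =>
    (hmin g hg).lt_of_ne fun e => hgu (h.inj u hu g hg e).symm
  refine ⟨?_, ?_, ?_, ?_, ?_, ?_, ?_⟩
  · intro v
    by_cases hvu : v = u
    · exact Or.inl (Or.inl hvu)
    · exact (h.cover v).imp Or.inr fun hv => ⟨hv, hvu⟩
  · rintro v (rfl | hv) ⟨hvU, hvu⟩
    · exact hvu rfl
    · exact h.disj v hv hvU
  · rintro x (rfl | hx) y (rfl | hy) hxy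
    · exact G.loopless.irrefl _ hxy
    · exact hno y hy hxy.symm
    · exact hno x hx hxy
    · exact h.indep x hx y hy hxy
  · exact fun x hx y hy => h.inj x hx.1 y hy.1
  · exact fun x hx y hy z hz => h.umbrella x hx.1 y hy.1 z hz.1
  · rintro v (rfl | hv) x hx y hy z hz hvx hvz hxy hyz
    · exact (h.first_of_le hu hmin hy.1 hz.1 (Or.inr hvz) hyz).resolve_left hy.2
    · exact h.consec v hv x hx.1 y hy.1 z hz.1 hvx hvz hxy hyz
  · intro u' hu' hmin' v hv g hg
    have hgu : g ≠ u := by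
      rintro rfl
      rcases hv with rfl | hv
      · exact G.loopless.irrefl _ hg
      · exact hno v hv hg
    have hgU : g ∈ U ∧ G.Adj u g := by
      rcases hv with rfl | hv
      · exact ⟨(h.cover g).resolve_left fun hgI => hno g hgI hg.symm, hg⟩
      · exact ⟨h.mem_of_adj hv hg, (h.first u hu hmin v hv g hg).resolve_left hgu⟩
    refine or_iff_not_imp_left.2 fun hne => ?_
    have hle := h.first_of_le hu hmin hu'.1 hgU.1 (Or.inr hgU.2) (hmin' g ⟨hgU.1, hgu⟩)
    exact h.adj_of_first hu hmin hu'.1 hgU.1 hle (Or.inr hgU.2) (Ne.symm hne)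

/-- Moving the first vertex of `U` to `I` keeps the subgraph induced by `N[I]` threshold. -/
theorem isThresholdGraph_insert_first [Fintype V] (h : IsRankedPartition G I U f)
    (hthr : IsThresholdGraph (G.induce (closedNbhd G I))) {u : V} (hu : u ∈ U)
    (hmin : ∀ g ∈ U, f u ≤ f g) (hno : ∀ v ∈ I, ¬ G.Adj v u) :
    IsThresholdGraph (G.induce (closedNbhd G (insert u I))) := by
  classical
  obtain ⟨w₀, T, hw₀, hT, hw₀T⟩ := hthr
  obtain ⟨w, hw, hwT⟩ : ∃ w : V → ℝ, (∀ v, 0 < w v) ∧ ∀ a ∈ closedNbhd G I,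
      ∀ b ∈ closedNbhd G I, a ≠ b → (G.Adj a b ↔ T ≤ w a + w b) := by
    refine ⟨fun v => if hv : v ∈ closedNbhd G I then w₀ ⟨v, hv⟩ else 1, fun v => ?_, ?_⟩
    · dsimp only
      split_ifs
      exacts [hw₀ _, one_pos]
    · intro a ha b hb hab
      simp only [dif_pos ha, dif_pos hb]
      exact hw₀T ⟨a, ha⟩ ⟨b, hb⟩ fun e => hab (congrArg Subtype.val e)
  set S : ℝ := ∑ v, w v with hS
  have hwS : ∀ v, w v ≤ S := fun v =>
    Finset.single_le_sum (fun i _ => (hw i).le) (Finset.mem_univ v)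
  have hSpos : 0 < S := (hw u).trans_le (hwS u)
  have hmemI : ∀ v ∈ I, v ∈ closedNbhd G I := fun v hv => Or.inl hv
  have hmemU : ∀ a ∈ closedNbhd G (insert u I), a ∉ I → a ∈ U ∧ (a = u ∨ G.Adj u a) := by
    rintro a ((rfl | ha) | ⟨v, rfl | hv, hva⟩) haI
    · exact ⟨hu, Or.inl rfl⟩
    · exact absurd ha haI
    · exact ⟨(h.cover a).resolve_left haI, Or.inr hva⟩
    · exact ⟨h.mem_of_adj hv hva, h.first u hu hmin v hv a hva⟩
  have hnotAdj : ∀ a ∈ I, ∀ b, b ∉ closedNbhd G I → ¬ G.Adj a b := fun a ha b hb hab =>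
    hb (Or.inr ⟨a, ha, hab⟩)
  refine ⟨fun a => if (a : V) ∈ I then w a else if (a : V) ∈ closedNbhd G I then
    w a + (T + 2 * S) else T + S, T + (T + 2 * S), fun a => ?_, by positivity, ?_⟩
  · have := hw a
    dsimp only
    split_ifs <;> positivity
  rintro ⟨a, ha⟩ ⟨b, hb⟩ hab
  have hab' : a ≠ b := fun e => hab (Subtype.ext e)
  have hwa := hw a
  have hwb := hw b
  have haS := hwS a
  have hbS := hwS b
  simp only [SimpleGraph.comap_adj, Function.Embedding.subtype_apply]
  by_cases haI : a ∈ I <;> by_cases hbI : b ∈ I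
  · simp only [haI, hbI, if_true]
    exact iff_of_false (h.indep a haI b hbI) (by linarith)
  · by_cases hbN : b ∈ closedNbhd G I
    · simp only [haI, hbI, hbN, if_true, if_false]
      rw [hwT a (hmemI a haI) b hbN hab']
      constructor <;> intro <;> linarith
    · simp only [haI, hbI, hbN, if_true, if_false]
      exact iff_of_false (hnotAdj a haI b hbN) (by linarith)
  · by_cases haN : a ∈ closedNbhd G I
    · simp only [haI, hbI, haN, if_true, if_false]
      rw [hwT a haN b (hmemI b hbI) hab']
      constructor <;> intro <;> linarith
    · simp only [haI, hbI, haN, if_true, if_false]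
      exact iff_of_false (fun e => hnotAdj b hbI a haN e.symm) (by linarith)
  · have ha' := hmemU a ha haI
    have hb' := hmemU b hb hbI
    simp only [haI, hbI, if_false]
    refine iff_of_true (h.adj_of_first hu hmin ha'.1 hb'.1 ha'.2 hb'.2 hab') ?_
    split_ifs <;> linarith

/-- In a canonical partition the first vertex of `U` has a neighbour in `I`. -/
theorem exists_adj_first [Fintype V] (h : IsRankedPartition G I U f)
    (hcan : IsCanonicalPTPartition G I U) {u : V} (hu : u ∈ U) (hmin : ∀ g ∈ U, f u ≤ f g) :
    ∃ v ∈ I, G.Adj v u := by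
  by_contra! hno
  obtain ⟨⟨-, -, -, ⟨l, hl⟩, hthr, -⟩, hmax⟩ := hcan
  refine hmax u hu ((h.move_first hu hmin hno).isPairedThresholdPartition
    ⟨fun x => l ⟨x, x.2.1⟩, fun x y hxy => hl ⟨x, x.2.1⟩ ⟨y, y.2.1⟩ fun e => hxy ?_⟩
    (h.isThresholdGraph_insert_first hthr hu hmin hno))
  exact Subtype.ext (Subtype.mk.inj e)

/-- In a connected graph, every vertex of `U` other than the last one has a neighbour of higher
rank in `U`. -/
theorem exists_adj_lt (h : IsRankedPartition G I U f) (hconn : G.Connected) {u b z : V}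
    (hu : u ∈ U) (hmin : ∀ g ∈ U, f u ≤ f g) (hb : b ∈ U) (hz : z ∈ U) (hbz : f b < f z) :
    ∃ y ∈ U, f b < f y ∧ G.Adj b y := by
  by_contra! hno
  have hcross : ∀ x ∈ U, ∀ y ∈ U, f x ≤ f b → f b < f y → ¬ G.Adj x y := by
    intro x hx y hy hxb hby hxy
    rcases hxb.eq_or_lt with e | hlt
    · rw [h.inj x hx b hb e] at hxy
      exact hno y hy hby hxy
    · exact hno y hy hby (h.umbrella x hx b hb y hy hlt hby hxy).2
  let S : Set V := {x | (x ∈ U ∧ f x ≤ f b) ∨ (x ∈ I ∧ ∃ y ∈ U, f y ≤ f b ∧ G.Adj x y)}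
  have hbS : b ∈ S := Or.inl ⟨hb, le_rfl⟩
  have hzS : z ∉ S := by
    rintro (⟨-, hle⟩ | ⟨hzI, -⟩)
    · omega
    · exact h.disj z hzI hz
  obtain ⟨p⟩ := hconn.preconnected b z
  obtain ⟨d, -, hd, hd'⟩ := p.exists_boundary_dart S hbS hzS
  have hadj := d.adj
  rcases hd with ⟨hU, hle⟩ | ⟨hI, y, hyU, hyb, hy⟩
  · rcases h.cover d.snd with hsI | hsU
    · exact hd' (Or.inr ⟨hsI, d.fst, hU, hle, hadj.symm⟩)
    · exact hcross _ hU _ hsU hle (not_le.1 fun hle' => hd' (Or.inl ⟨hsU, hle'⟩)) hadj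
  · have hsU := h.mem_of_adj hI hadj
    have hlt : f b < f d.snd := not_le.1 fun hle' => hd' (Or.inl ⟨hsU, hle'⟩)
    refine hcross y hyU _ hsU hyb hlt (h.adj_of_first hu hmin hyU hsU
      (h.first u hu hmin _ hI _ hy) (h.first u hu hmin _ hI _ hadj) ?_)
    rintro rfl
    omega

/-- Let `v ∈ I` and let `P` be a union of components of `G - N[v]` that misses the last vertex
of `U`. In a canonical partition, no maximal clique within `U` is contained in `P ∪ N[v]`. -/
theorem not_subset_of_separated [Fintype V] (h : IsRankedPartition G I U f) (hconn : G.Connected)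
    (hcan : IsCanonicalPTPartition G I U)
    (hnest : ∀ v ∈ I, ∀ v' ∈ I, G.neighborSet v ⊆ G.neighborSet v' ∨
      G.neighborSet v' ⊆ G.neighborSet v)
    {u z : V} (hu : u ∈ U) (hmin : ∀ g ∈ U, f u ≤ f g) (hz : z ∈ U) (hmax : ∀ g ∈ U, f g ≤ f z)
    {v : V} (hv : v ∈ I) {K : Set V} (hK : IsMaximalClique G K) (hKU : K ⊆ U)
    {P : Set V} (hPv : ∀ g ∈ P, ¬ G.Adj v g) (hvP : v ∉ P)
    (hP : ∀ g ∈ P, ∀ y, G.Adj g y → y ∈ P ∨ y = v ∨ G.Adj v y) (hzP : z ∉ P) :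
    ¬ K ⊆ P ∪ G.neighborSet v := by
  intro hsub
  have hfirst := h.first u hu hmin
  have hne : (P ∩ U).Nonempty := by
    by_contra! hempty
    have hKv : ∀ g ∈ K, G.Adj v g := fun g hg => (hsub hg).resolve_left fun hgP =>
      (hempty ▸ (⟨hgP, hKU hg⟩ : g ∈ P ∩ U) : g ∈ (∅ : Set V))
    have hins : G.IsClique (insert v K) := hK.1.insert fun g hg _ => hKv g hg
    have hvK : v ∈ K := by
      rw [hK.2 _ hins (Set.subset_insert v K)]
      exact Set.mem_insert v K
    exact h.disj v hv (hKU hvK)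
  obtain ⟨b, ⟨hbP, hbU⟩, hbmax⟩ := Set.exists_max_image (P ∩ U) f (Set.toFinite _) hne
  have hbz : f b < f z := (hmax b hbU).lt_of_ne fun e => hzP (h.inj b hbU z hz e ▸ hbP)
  have hright : ∀ y ∈ U, f b < f y → G.Adj b y → G.Adj v y := by
    intro y hy hlt hby
    rcases hP b hbP y hby with hyP | rfl | hvy
    · exact absurd (hbmax y ⟨hyP, hy⟩) (not_le.2 hlt)
    · exact absurd hy (h.disj y hv)
    · exact hvy
  obtain ⟨y, hyU, hby, hadj⟩ := h.exists_adj_lt hconn hu hmin hbU hz hbz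
  have hvy := hright y hyU hby hadj
  have hvlt : ∀ g, G.Adj v g → f b < f g := fun g hg => not_le.1 fun hle =>
    hPv b hbP (h.consec v hv g (h.mem_of_adj hv hg) b hbU y hyU hg hvy hle hby.le)
  have hle_first : ∀ g ∈ U, f g ≤ f b → g = u ∨ G.Adj u g := fun g hg hgb =>
    h.first_of_le hu hmin hg hyU (hfirst v hv y hvy) (hgb.trans hby.le)
  have hKfirst : ∀ g ∈ K, g = u ∨ G.Adj u g := by
    intro g hg
    rcases hsub hg with hgP | hgv
    · exact hle_first g (hKU hg) (hbmax g ⟨hgP, hKU hg⟩)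
    · exact hfirst v hv g hgv
  obtain ⟨v', hv', hv'u⟩ := h.exists_adj_first hcan hu hmin
  have hvv' : G.neighborSet v ⊆ G.neighborSet v' :=
    (hnest v hv v' hv').resolve_right fun hsub' => absurd (hvlt u (hsub' hv'u))
      (not_lt.2 (hmin b hbU))
  have hKv' : ∀ g ∈ K, G.Adj v' g := by
    intro g hg
    rcases le_or_gt (f g) (f b) with hle | hlt
    · exact h.consec v' hv' u hu g (hKU hg) y hyU hv'u (hvv' hvy) (hmin g (hKU hg))
        (hle.trans hby.le)
    · refine hvv' (hright g (hKU hg) hlt (h.adj_of_first hu hmin hbU (hKU hg)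
        (hle_first b hbU le_rfl) (hKfirst g hg) ?_))
      rintro rfl
      omega
  have hins : G.IsClique (insert v' K) := hK.1.insert fun g hg _ => hKv' g hg
  have hvK : v' ∈ K := by
    rw [hK.2 _ hins (Set.subset_insert v' K)]
    exact Set.mem_insert v' K
  exact h.disj v' hv' (hKU hvK)

/-- A maximal clique meeting `I` is the closed neighbourhood of a vertex of `I`. -/
theorem eq_insert_neighborSet (h : IsRankedPartition G I U f) {u : V} (hu : u ∈ U)
    (hmin : ∀ g ∈ U, f u ≤ f g) {K : Set V} (hK : IsMaximalClique G K) {v : V} (hv : v ∈ I)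
    (hvK : v ∈ K) : K = insert v (G.neighborSet v) := by
  refine hK.2 _ (SimpleGraph.IsClique.insert (fun x hx y hy hxy => ?_) fun y hy _ => hy) ?_
  · exact h.adj_of_first hu hmin (h.mem_of_adj hv hx) (h.mem_of_adj hv hy)
      (h.first u hu hmin v hv x hx) (h.first u hu hmin v hv y hy) hxy
  · intro g hg
    by_cases hgv : g = v
    · exact Or.inl hgv
    · exact Or.inr (hK.1 hvK hg (Ne.symm hgv))

end IsRankedPartition

/-- If `N[I]` induces a threshold graph and `I` is independent, the neighbourhoods of the vertices
of `I` increase along some weight function. -/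
theorem IsThresholdGraph.exists_weight {V : Type*} {G : SimpleGraph V} {I : Set V}
    (hthr : IsThresholdGraph (G.induce (closedNbhd G I))) (hind : ∀ x ∈ I, ∀ y ∈ I, ¬ G.Adj x y) :
    ∃ w : V → ℝ, ∀ v ∈ I, ∀ v' ∈ I, w v ≤ w v' → G.neighborSet v ⊆ G.neighborSet v' := by
  classical
  obtain ⟨w, T, -, -, hw⟩ := hthr
  refine ⟨fun v => if hv : v ∈ closedNbhd G I then w ⟨v, hv⟩ else 0, ?_⟩
  intro v hv v' hv' hle g hg
  have hvN : v ∈ closedNbhd G I := Or.inl hv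
  have hvN' : v' ∈ closedNbhd G I := Or.inl hv'
  have hgN : g ∈ closedNbhd G I := Or.inr ⟨v, hv, hg⟩
  have hne : v' ≠ g := by
    rintro rfl
    exact hind v hv v' hv' hg
  simp only [dif_pos hvN, dif_pos hvN'] at hle
  have h₁ := (hw ⟨v, hvN⟩ ⟨g, hgN⟩ fun e => hg.ne (congrArg Subtype.val e)).1 hg
  exact (hw ⟨v', hvN'⟩ ⟨g, hgN⟩ fun e => hne (congrArg Subtype.val e)).2 (by linarith)

/-- Every clique of a finite graph is contained in a maximal clique. -/
theorem SimpleGraph.IsClique.exists_isMaximalClique {V : Type*} [Finite V] {G : SimpleGraph V}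
    {s : Set V} (hs : G.IsClique s) : ∃ t, s ⊆ t ∧ IsMaximalClique G t := by
  obtain ⟨t, hst, ht⟩ := Set.Finite.exists_le_maximal (Set.toFinite {t : Set V | G.IsClique t}) hs
  exact ⟨t, hst, ht.prop, fun t' ht' hle => hle.antisymm (ht.le_of_ge ht' hle)⟩

namespace IsCliquePath

variable {V : Type*} {G : SimpleGraph V} {ℓ : ℕ} {C : Fin ℓ → Set V}

theorem rev (h : IsCliquePath G C) : IsCliquePath G (C ∘ Fin.rev) := by
  obtain ⟨hinj, hmax, hall, hcons⟩ := h
  refine ⟨hinj.comp Fin.rev_injective, fun i => hmax _, fun s hs => ?_,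
    fun v i j k hij hjk hi hk => ?_⟩
  · obtain ⟨i, rfl⟩ := hall s hs
    exact ⟨i.rev, by simp⟩
  · exact hcons v k.rev j.rev i.rev (Fin.rev_le_rev.2 hjk) (Fin.rev_le_rev.2 hij) hk hi

theorem exists_mem_of_adj [Finite V] (h : IsCliquePath G C) {x y : V} (hxy : G.Adj x y) :
    ∃ i, x ∈ C i ∧ y ∈ C i := by
  have hcl : G.IsClique {x, y} := SimpleGraph.isClique_pair.2 fun _ => hxy
  obtain ⟨t, ht, hmax⟩ := hcl.exists_isMaximalClique
  obtain ⟨i, rfl⟩ := h.2.2.1 t hmax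
  exact ⟨i, ht (Or.inl rfl), ht (Or.inr rfl)⟩

theorem exists_mem [Finite V] (h : IsCliquePath G C) (x : V) : ∃ i, x ∈ C i := by
  obtain ⟨t, ht, hmax⟩ := (SimpleGraph.isClique_singleton (G := G) x).exists_isMaximalClique
  obtain ⟨i, rfl⟩ := h.2.2.1 t hmax
  exact ⟨i, ht rfl⟩

/-- Along a clique path whose last-vertex clique lies to the right of a clique meeting `I`, no
clique avoiding `I` lies to the left of it. -/
theorem not_lt_of_canonical [Fintype V] {I U : Set V} {f : V → ℕ} (hC : IsCliquePath G C)
    (h : IsRankedPartition G I U f) (hconn : G.Connected) (hcan : IsCanonicalPTPartition G I U)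
    (hnest : ∀ v ∈ I, ∀ v' ∈ I, G.neighborSet v ⊆ G.neighborSet v' ∨
      G.neighborSet v' ⊆ G.neighborSet v)
    {u z : V} (hu : u ∈ U) (hmin : ∀ g ∈ U, f u ≤ f g) (hz : z ∈ U) (hmax : ∀ g ∈ U, f g ≤ f z)
    {n s d : Fin ℓ} (hs : (C s ∩ I).Nonempty) (hn : ¬ (C n ∩ I).Nonempty) (hzd : z ∈ C d)
    (hzs : z ∉ C s) (hsd : s < d) : ¬ n < s := by
  intro hns
  obtain ⟨v, hvs, hv⟩ := hs
  have hCs := h.eq_insert_neighborSet hu hmin (hC.2.1 s) hv hvs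
  have hKU : C n ⊆ U := fun g hg => (h.cover g).resolve_left fun hgI => hn ⟨g, hg, hgI⟩
  refine h.not_subset_of_separated hconn hcan hnest hu hmin hz hmax hv (hC.2.1 n) hKU
    (P := {g | g ∉ C s ∧ ∃ i < s, g ∈ C i}) ?_ ?_ ?_ ?_ ?_
  · rintro g ⟨hg, -⟩ hvg
    exact hg (hCs ▸ Or.inr hvg)
  · exact fun hvP => hvP.1 hvs
  · rintro g ⟨hg, i, his, hgi⟩ y hgy
    by_cases hy : y ∈ C s
    · rw [hCs] at hy
      exact Or.inr hy
    · obtain ⟨j, hgj, hyj⟩ := hC.exists_mem_of_adj hgy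
      refine Or.inl ⟨hy, j, not_le.1 fun hsj => hg ?_, hyj⟩
      exact hC.2.2.2 g i s j his.le hsj hgi hgj
  · rintro ⟨-, i, his, hzi⟩
    exact hzs (hC.2.2.2 z i s d his.le hsd.le hzi hzd)
  · intro g hg
    by_cases hgs : g ∈ C s
    · rw [hCs] at hgs
      refine Or.inr (hgs.resolve_left ?_)
      rintro rfl
      exact h.disj g hv (hKU hg)
    · exact Or.inl ⟨hgs, n, hns, hg⟩

end IsCliquePath

/-- If deleting the universal vertices leaves a connected graph, every vertex has a non-universal
neighbour. -/
theorem exists_adj_not_universal {V : Type*} {G : SimpleGraph V}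
    (hconn : (G.induce {v : V | ¬ ∀ u : V, u ≠ v → G.Adj v u}).Connected) (v : V) :
    ∃ x y, G.Adj v x ∧ y ≠ x ∧ ¬ G.Adj x y := by
  by_cases hv : ∀ u : V, u ≠ v → G.Adj v u
  · obtain ⟨x, hx⟩ := hconn.nonempty
    have hxv : x ≠ v := by
      rintro rfl
      exact hx hv
    simp only [Set.mem_ofPred_eq, not_forall] at hx
    obtain ⟨y, hyx, hxy⟩ := hx
    exact ⟨x, y, hv x hxv, hyx, hxy⟩
  · have hv' := hv
    simp only [not_forall] at hv'
    obtain ⟨t, htv, hvt⟩ := hv'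
    have ht : ¬ ∀ u : V, u ≠ t → G.Adj t u := fun ht => hvt (ht v htv.symm).symm
    obtain ⟨p⟩ := hconn.preconnected ⟨v, hv⟩ ⟨t, ht⟩
    cases p with
    | nil => exact absurd rfl htv
    | @cons _ x _ hadj _ =>
      have hx := x.2
      simp only [Set.mem_ofPred_eq, not_forall] at hx
      obtain ⟨y, hyx, hxy⟩ := hx
      exact ⟨x, y, hadj, hyx, hxy⟩

/-- If a connected paired threshold graph with canonical
partition `I ⊎ U`, `p = |I|`, stays connected after deleting all universal
vertices, then in any clique path the cliques meeting `I` are among the first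
`p` ones or among the last `p` ones. -/
theorem clique_path_I_cliques_at_end {V : Type*} [Fintype V]
    (G : SimpleGraph V) (hconn : G.Connected) (hG : IsPairedThresholdGraph G)
    (I U : Set V) (hcan : IsCanonicalPTPartition G I U)
    (hconn' : (G.induce {v : V | ¬ ∀ u : V, u ≠ v → G.Adj v u}).Connected) :
    ∀ (ℓ : ℕ) (C : Fin ℓ → Set V), IsCliquePath G C →
      (∀ i : Fin ℓ, (C i ∩ I).Nonempty → (i : ℕ) < I.ncard) ∨
      (∀ i : Fin ℓ, (C i ∩ I).Nonempty → ℓ - I.ncard ≤ (i : ℕ)) := by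
  classical
  intro ℓ C hC
  rcases I.eq_empty_or_nonempty with rfl | hI
  · exact Or.inl fun i hi => absurd hi (by simp)
  obtain ⟨f, h⟩ := hcan.1.exists_ranking
  obtain ⟨w, hw⟩ := hcan.1.2.2.2.2.1.exists_weight h.indep
  have hnest : ∀ v ∈ I, ∀ v' ∈ I, G.neighborSet v ⊆ G.neighborSet v' ∨
      G.neighborSet v' ⊆ G.neighborSet v := fun v hv v' hv' =>
    (le_total (w v) (w v')).imp (hw v hv v' hv') (hw v' hv' v hv)
  obtain ⟨v₀, hv₀, hv₀min⟩ := Set.exists_min_image I w (Set.toFinite I) hI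
  obtain ⟨x, y, hv₀x, hyx, hxy⟩ := exists_adj_not_universal hconn' v₀
  have hIx : ∀ v ∈ I, G.Adj v x := fun v hv => hw v₀ hv₀ v hv (hv₀min v hv) hv₀x
  have hxU : x ∈ U := h.mem_of_adj hv₀ hv₀x
  have hyU : y ∈ U := (h.cover y).resolve_left fun hy => hxy (hIx y hy).symm
  obtain ⟨u, hu, hmin⟩ := Set.exists_min_image U f (Set.toFinite U) ⟨x, hxU⟩
  obtain ⟨z, hz, hmax⟩ := Set.exists_max_image U f (Set.toFinite U) ⟨x, hxU⟩
  have hux := h.first u hu hmin v₀ hv₀ x hv₀x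
  have hlt : f x < f y := not_le.1 fun hle => hxy
    (h.adj_of_first hu hmin hxU hyU hux (h.first_of_le hu hmin hyU hxU hux hle) hyx.symm)
  have hxz : ¬ G.Adj x z := by
    intro hxz
    rcases (hmax y hyU).eq_or_lt with e | hlt'
    · rw [h.inj y hyU z hz e] at hxy
      exact hxy hxz
    · exact hxy (h.umbrella x hxU y hyU z hz hlt hlt' hxz).1
  have hne : x ≠ z := by
    rintro rfl
    exact absurd (hmax y hyU) (not_le.2 hlt)
  have hxC : ∀ i, (C i ∩ I).Nonempty → x ∈ C i := by
    rintro i ⟨v, hvi, hv⟩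
    rw [h.eq_insert_neighborSet hu hmin (hC.2.1 i) hv hvi]
    exact Or.inr (hIx v hv)
  have hsep : ∀ i, x ∈ C i → z ∉ C i := fun i hxi hzi => hxz ((hC.2.1 i).1 hxi hzi hne)
  obtain ⟨d, hzd⟩ := hC.exists_mem z
  let S : Finset (Fin ℓ) := Finset.univ.filter fun i => (C i ∩ I).Nonempty
  have hScard : S.card ≤ I.ncard := by
    have : Nonempty V := ⟨x⟩
    choose! g hg using fun (i : Fin ℓ) (hi : (C i ∩ I).Nonempty) => hi
    rw [← Set.ncard_coe_finset S]
    refine Set.ncard_le_ncard_of_injOn g (fun i hi => (hg i (by simpa [S] using hi)).2) ?_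
    intro i hi j hj hij
    have hi' := hg i (by simpa [S] using hi)
    have hj' := hg j (by simpa [S] using hj)
    apply hC.1
    rw [h.eq_insert_neighborSet hu hmin (hC.2.1 i) hi'.2 hi'.1,
      h.eq_insert_neighborSet hu hmin (hC.2.1 j) hj'.2 hj'.1, hij]
  by_cases hside : ∃ s, (C s ∩ I).Nonempty ∧ d < s
  · right
    obtain ⟨s, hs, hds⟩ := hside
    intro i hi
    have hdi : d < i := by
      by_contra! hle
      exact hsep d (hC.2.2.2 x i d s hle hds.le (hxC i hi) (hxC s hs)) hzd
    have hsub : Finset.Ici i ⊆ S := by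
      intro n hn
      rw [Finset.mem_Ici] at hn
      by_contra hnS
      have hnI : ¬ (C n ∩ I).Nonempty := by simpa [S] using hnS
      have hin : i < n := hn.lt_of_ne fun e => hnI (e ▸ hi)
      exact hC.rev.not_lt_of_canonical h hconn hcan hnest hu hmin hz hmax
        (n := n.rev) (s := i.rev) (d := d.rev) (by simpa using hi) (by simpa using hnI)
        (by simpa using hzd) (by simpa using hsep i (hxC i hi)) (Fin.rev_lt_rev.2 hdi)
        (Fin.rev_lt_rev.2 hin)
    have hcard := Finset.card_le_card hsub
    rw [Fin.card_Ici] at hcard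
    omega
  · left
    push Not at hside
    intro i hi
    have hid : i < d := (hside i hi).lt_of_ne fun e => hsep i (hxC i hi) (e ▸ hzd)
    have hsub : Finset.Iic i ⊆ S := by
      intro n hn
      rw [Finset.mem_Iic] at hn
      by_contra hnS
      have hnI : ¬ (C n ∩ I).Nonempty := by simpa [S] using hnS
      have hni : n < i := hn.lt_of_ne fun e => hnI (e ▸ hi)
      exact hC.not_lt_of_canonical h hconn hcan hnest hu hmin hz hmax hi hnI hzd
        (hsep i (hxC i hi)) hid hni
    have hcard := Finset.card_le_card hsub
    rw [Fin.card_Iic] at hcard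
    omega
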